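/- arXiv:2502.18019 — 2 statements merged into one kernel-verified Lean document; each statement's English description precedes it below -/
import Mathlib

section
/- For all n ∈ ℕ, all k ∈ {1,…,n}, and all x ∈ ℝ^n: ∂_k α_{n,i}(x) = (1 − 2α_{n,k+1}(x)) ∏_{j=i}^{k−1}(1 − 2x_j) for every i ∈ {1,…,k}, and ∂_k α_{n,i}(x) = 0 for every i ∈ {k+1,…,n+1}. -/
open Finset

/-- `alphaF n x i` is the recursively defined `α_{n,i}(x)`:
`α_{n,n+1}(x) = 0` and `α_{n,i}(x) = x_i + (1 - 2 x_i) α_{n,i+1}(x)` for `i = 1, …, n`. -/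
noncomputable def alphaF (n : ℕ) (x : ℕ → ℝ) (i : ℕ) : ℝ :=
  if h : n + 1 ≤ i then 0 else x i + (1 - 2 * x i) * alphaF n x (i + 1)
termination_by n + 1 - i
decreasing_by omega

/-- `betaF n x i = 2^i (x_i - x_i²)(1 - x_{i-1} + Σ_{j=1}^{i-2} x_j)`, with `x_0 := 1`. -/
noncomputable def betaF (n : ℕ) (x : ℕ → ℝ) (i : ℕ) : ℝ :=
  (2 : ℝ) ^ i * (x i - x i ^ 2) *
    (1 - (if i = 1 then 1 else x (i - 1)) + ∑ j ∈ Finset.Icc 1 (i - 2), x j)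

/-- `Ffun n x = Σ_{i=1}^n (2^{i-1} α_{n,i}(x) - β_{n,i}(x))`. -/
noncomputable def Ffun (n : ℕ) (x : ℕ → ℝ) : ℝ :=
  ∑ i ∈ Finset.Icc 1 n, ((2 : ℝ) ^ (i - 1) * alphaF n x i - betaF n x i)

/-- `partialF n k x` is the partial derivative `∂_k F_n(x)`. -/
noncomputable def partialF (n k : ℕ) (x : ℕ → ℝ) : ℝ :=
  deriv (fun t => Ffun n (Function.update x k t)) (x k)

/-- `partialAlpha n k i x` is the partial derivative `∂_k α_{n,i}(x)`. -/
noncomputable def partialAlpha (n k i : ℕ) (x : ℕ → ℝ) : ℝ :=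
  deriv (fun t => alphaF n (Function.update x k t) i) (x k)

/-- `Pfun n x k = x_{k-1} ∏_{j=1}^{k-2} (1 - x_j)`, with `x_0 := 1`. -/
noncomputable def Pfun (n : ℕ) (x : ℕ → ℝ) (k : ℕ) : ℝ :=
  (if k = 1 then 1 else x (k - 1)) * ∏ j ∈ Finset.Icc 1 (k - 2), (1 - x j)

/-- `Sfun n x k = Σ_{j=k+1}^n x_j`. -/
noncomputable def Sfun (n : ℕ) (x : ℕ → ℝ) (k : ℕ) : ℝ :=
  ∑ j ∈ Finset.Icc (k + 1) n, x j

/-- Two real numbers (which will take integer values) have the same parity. -/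
def SameParity (a b : ℝ) : Prop := ∃ m : ℤ, a - b = 2 * (m : ℝ)

/-- The `k`-th standard unit vector, as a function `ℕ → ℝ` (coordinates `1, …, n`). -/
noncomputable def unitVec (k : ℕ) : ℕ → ℝ := fun i => if i = k then 1 else 0

theorem alphaF_rec (n : ℕ) (x : ℕ → ℝ) (i : ℕ) (h : i ≤ n) :
    alphaF n x i = x i + (1 - 2 * x i) * alphaF n x (i + 1) := by
  rw [alphaF, dif_neg (by omega)]

theorem alphaF_upd (n k : ℕ) (x : ℕ → ℝ) (t : ℝ) (m : ℕ) :
    ∀ i, n + 1 - i = m → k < i → alphaF n (Function.update x k t) i = alphaF n x i := by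
  induction m with
  | zero =>
    intro i hi hk
    rw [alphaF, dif_pos (by omega), alphaF, dif_pos (by omega)]
  | succ m ih =>
    intro i hi hk
    rw [alphaF_rec _ _ _ (by omega), alphaF_rec n x i (by omega),
      ih (i + 1) (by omega) (by omega), Function.update_of_ne (by omega)]

theorem alphaF_hasDeriv (n k : ℕ) (hkn : k ≤ n) (hk1 : 1 ≤ k) (x : ℕ → ℝ) (m : ℕ) :
    ∀ i, i + m = k → HasDerivAt (fun t => alphaF n (Function.update x k t) i)
      ((1 - 2 * alphaF n x (k + 1)) * ∏ j ∈ Finset.Icc i (k - 1), (1 - 2 * x j)) (x k) := by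
  induction m with
  | zero =>
    intro i hi
    obtain rfl : i = k := by omega
    have h : (fun t => alphaF n (Function.update x i t) i) =
        fun t => t + (1 - 2 * t) * alphaF n x (i + 1) := by
      funext t
      rw [alphaF_rec _ _ _ hkn, alphaF_upd n i x t _ (i + 1) rfl (by omega),
        Function.update_self]
    rw [h, Finset.Icc_eq_empty (by omega), Finset.prod_empty]
    have := (hasDerivAt_id' (x i)).add
      ((((hasDerivAt_id' (x i)).const_mul 2).const_sub 1).mul_const (alphaF n x (i + 1)))
    refine this.congr_deriv ?_
    ring
  | succ m ih =>
    intro i hi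
    have h : (fun t => alphaF n (Function.update x k t) i) =
        fun t => x i + (1 - 2 * x i) * alphaF n (Function.update x k t) (i + 1) := by
      funext t
      rw [alphaF_rec _ _ _ (by omega), Function.update_of_ne (by omega)]
    rw [h]
    refine (((ih (i + 1) (by omega)).const_mul (1 - 2 * x i)).const_add (x i)).congr_deriv ?_
    have e : Finset.Icc i (k - 1) = insert i (Finset.Icc (i + 1) (k - 1)) := by
      ext j
      simp only [Finset.mem_insert, Finset.mem_Icc]
      omega
    rw [e, Finset.prod_insert (by simp)]
    ring

theorem stmt6 (n k : ℕ) (hk : k ∈ Finset.Icc 1 n) (x : ℕ → ℝ) :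
    (∀ i ∈ Finset.Icc 1 k,
      partialAlpha n k i x =
        (1 - 2 * alphaF n x (k + 1)) * ∏ j ∈ Finset.Icc i (k - 1), (1 - 2 * x j)) ∧
    (∀ i ∈ Finset.Icc (k + 1) (n + 1), partialAlpha n k i x = 0) := by
  rw [Finset.mem_Icc] at hk
  constructor
  · intro i hi
    rw [Finset.mem_Icc] at hi
    exact (alphaF_hasDeriv n k hk.2 hk.1 x (k - i) i (by omega)).deriv
  · intro i hi
    rw [Finset.mem_Icc] at hi
    have h : (fun t => alphaF n (Function.update x k t) i) = fun _ => alphaF n x i := by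
      funext t
      exact alphaF_upd n k x t _ i rfl (by omega)
    rw [partialAlpha, h, deriv_const]
end

section
/- For all n ∈ ℕ, the function F_n is injective on the vertex set {0,1}^n: if x, y ∈ {0,1}^n and x ≠ y, then F_n(x) ≠ F_n(y). -/
open Finset

theorem aux_bound (a : ℕ → ℝ) (n : ℕ) (h : ∀ i ∈ Finset.Icc 1 n, a i = 0 ∨ a i = 1) :
    0 ≤ ∑ i ∈ Finset.Icc 1 n, (2 : ℝ) ^ (i - 1) * a i ∧
      ∑ i ∈ Finset.Icc 1 n, (2 : ℝ) ^ (i - 1) * a i ≤ 2 ^ n - 1 := by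
  induction n with
  | zero => simp
  | succ n ih =>
    have h1 := ih (fun i hi => h i (by simp only [Finset.mem_Icc] at *; omega))
    rw [Finset.sum_Icc_succ_top (by omega)]
    have hp : (0 : ℝ) < 2 ^ n := by positivity
    have e : (2 : ℝ) ^ (n + 1) = 2 * 2 ^ n := by ring
    simp only [Nat.add_sub_cancel]
    rw [e]
    rcases h (n + 1) (by simp) with h0 | h0 <;> rw [h0] <;> constructor <;> linarith [h1.1, h1.2]

theorem aux_inj (a b : ℕ → ℝ) (n : ℕ) (ha : ∀ i ∈ Finset.Icc 1 n, a i = 0 ∨ a i = 1)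
    (hb : ∀ i ∈ Finset.Icc 1 n, b i = 0 ∨ b i = 1)
    (h : ∑ i ∈ Finset.Icc 1 n, (2 : ℝ) ^ (i - 1) * a i
      = ∑ i ∈ Finset.Icc 1 n, (2 : ℝ) ^ (i - 1) * b i) :
    ∀ i ∈ Finset.Icc 1 n, a i = b i := by
  induction n with
  | zero => simp
  | succ n ih =>
    have ha' : ∀ i ∈ Finset.Icc 1 n, a i = 0 ∨ a i = 1 :=
      fun i hi => ha i (by simp only [Finset.mem_Icc] at *; omega)
    have hb' : ∀ i ∈ Finset.Icc 1 n, b i = 0 ∨ b i = 1 :=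
      fun i hi => hb i (by simp only [Finset.mem_Icc] at *; omega)
    have h1 := aux_bound a n ha'
    have h2 := aux_bound b n hb'
    rw [Finset.sum_Icc_succ_top (by omega), Finset.sum_Icc_succ_top (by omega)] at h
    simp only [Nat.add_sub_cancel] at h
    have e : a (n + 1) = b (n + 1) := by
      rcases ha (n + 1) (by simp) with h0 | h0 <;> rcases hb (n + 1) (by simp) with h3 | h3 <;>
        rw [h0, h3] at h <;> rw [h0, h3] <;> exfalso <;> linarith [h1.1, h1.2, h2.1, h2.2]
    rw [e] at h
    have h4 := ih ha' hb' (by linarith)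
    intro i hi
    by_cases hn : i = n + 1
    · rw [hn, e]
    · exact h4 i (by simp only [Finset.mem_Icc] at *; omega)

theorem aux_alpha (n : ℕ) (x : ℕ → ℝ) (hx : ∀ i ∈ Finset.Icc 1 n, x i = 0 ∨ x i = 1)
    (k : ℕ) : ∀ i, 1 ≤ i → n + 1 ≤ i + k → alphaF n x i = 0 ∨ alphaF n x i = 1 := by
  induction k with
  | zero => intro i _ h2; left; rw [alphaF, dif_pos (by omega)]
  | succ k ih =>
    intro i h1 h2
    rw [alphaF]
    split_ifs with h
    · left; rfl
    · rcases hx i (by simp only [Finset.mem_Icc]; omega) with h0 | h0 <;>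
        rcases ih (i + 1) (by omega) (by omega) with h3 | h3 <;> rw [h0, h3] <;> norm_num

theorem aux_F (n : ℕ) (x : ℕ → ℝ) (hx : ∀ i ∈ Finset.Icc 1 n, x i = 0 ∨ x i = 1) :
    Ffun n x = ∑ i ∈ Finset.Icc 1 n, (2 : ℝ) ^ (i - 1) * alphaF n x i := by
  unfold Ffun
  refine Finset.sum_congr rfl fun i hi => ?_
  rcases hx i hi with h | h <;> simp [betaF, h]

theorem stmt18 (n : ℕ) (x y : ℕ → ℝ)
    (hx : ∀ i ∈ Finset.Icc 1 n, x i = 0 ∨ x i = 1)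
    (hy : ∀ i ∈ Finset.Icc 1 n, y i = 0 ∨ y i = 1)
    (hne : ∃ i ∈ Finset.Icc 1 n, x i ≠ y i) :
    Ffun n x ≠ Ffun n y := by
  intro hF
  rw [aux_F n x hx, aux_F n y hy] at hF
  have hax : ∀ i, 1 ≤ i → alphaF n x i = 0 ∨ alphaF n x i = 1 :=
    fun i hi => aux_alpha n x hx (n + 1) i hi (by omega)
  have hay : ∀ i, 1 ≤ i → alphaF n y i = 0 ∨ alphaF n y i = 1 :=
    fun i hi => aux_alpha n y hy (n + 1) i hi (by omega)
  have key := aux_inj _ _ n (fun i hi => hax i (Finset.mem_Icc.1 hi).1)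
    (fun i hi => hay i (Finset.mem_Icc.1 hi).1) hF
  obtain ⟨i, hi, hne⟩ := hne
  apply hne
  have hi' := Finset.mem_Icc.1 hi
  have h1 := key i hi
  have h2 : alphaF n x (i + 1) = alphaF n y (i + 1) := by
    by_cases h : i = n
    · rw [alphaF, dif_pos (by omega), alphaF, dif_pos (by omega)]
    · exact key (i + 1) (by simp only [Finset.mem_Icc]; omega)
  rw [alphaF, alphaF.eq_def n y i, dif_neg (by omega), dif_neg (by omega), h2] at h1
  rcases hay (i + 1) (by omega) with h3 | h3 <;> rw [h3] at h1 <;> linarith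
end
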